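/- arXiv:math-ph/0508016 — 2 statements merged into one kernel-verified Lean document; each statement's English description precedes it below -/
import Mathlib

section
/- Let κ ≠ 0 be a real number and let Ω ⊆ {(t,x) ∈ ℝ² : t + x > 0} be open. Let u : ℝ² → ℝ be C² on Ω. Define Φ(t,x) = (t/κ, −(t+x)^((κ−1)/κ)·(κ(t+x)·u_x(t,x) − u(t,x))) and ũ(t,x) = (t+x)^(−1/κ)·(κ(t+x)·u_x(t,x) + (κ−1)·u(t,x)). Suppose V ⊆ ℝ² is open with Φ(Ω) ⊆ V, the Jacobian determinant of Φ is nonzero at every point of Ω, u satisfies the Euler–Poisson equation (EP) on Ω, and U : ℝ² → ℝ is C¹ on V with U(Φ(t,x)) = ũ(t,x) for all (t,x) ∈ Ω. Then for all (t,x) ∈ Ω, writing (t̃,x̃) = Φ(t,x), the first partial derivatives of U satisfy ∂U/∂t̃(t̃,x̃) = κ²·(t+x)^(−1/κ)·(u_t(t,x) − u_x(t,x)) and ∂U/∂x̃(t̃,x̃) = −1/(t+x). -/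
open Real Set

/-- Partial derivative with respect to the first variable. -/
noncomputable def pdt (f : ℝ × ℝ → ℝ) (p : ℝ × ℝ) : ℝ :=
  deriv (fun s => f (s, p.2)) p.1

/-- Partial derivative with respect to the second variable. -/
noncomputable def pdx (f : ℝ × ℝ → ℝ) (p : ℝ × ℝ) : ℝ :=
  deriv (fun s => f (p.1, s)) p.2

theorem DifferentiableAt.hasDerivAt_pdt {f : ℝ × ℝ → ℝ} {p : ℝ × ℝ}
    (hf : DifferentiableAt ℝ f p) : HasDerivAt (fun s => f (s, p.2)) (pdt f p) p.1 :=
  (DifferentiableAt.comp (g := f) p.1 hf (by fun_prop :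
    DifferentiableAt ℝ (fun s : ℝ => (s, p.2)) p.1)).hasDerivAt

theorem DifferentiableAt.hasDerivAt_pdx {f : ℝ × ℝ → ℝ} {p : ℝ × ℝ}
    (hf : DifferentiableAt ℝ f p) : HasDerivAt (fun s => f (p.1, s)) (pdx f p) p.2 :=
  (DifferentiableAt.comp (g := f) p.2 hf (by fun_prop :
    DifferentiableAt ℝ (fun s : ℝ => (p.1, s)) p.2)).hasDerivAt

theorem DifferentiableAt.fderiv_one_zero {f : ℝ × ℝ → ℝ} {p : ℝ × ℝ}
    (hf : DifferentiableAt ℝ f p) : fderiv ℝ f p (1, 0) = pdt f p :=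
  (HasFDerivAt.comp_hasDerivAt (l := f) p.1 hf.hasFDerivAt
    ((hasDerivAt_id p.1).prodMk (hasDerivAt_const p.1 p.2))).unique hf.hasDerivAt_pdt

theorem DifferentiableAt.fderiv_zero_one {f : ℝ × ℝ → ℝ} {p : ℝ × ℝ}
    (hf : DifferentiableAt ℝ f p) : fderiv ℝ f p (0, 1) = pdx f p :=
  (HasFDerivAt.comp_hasDerivAt (l := f) p.2 hf.hasFDerivAt
    ((hasDerivAt_const p.2 p.1).prodMk (hasDerivAt_id p.2))).unique hf.hasDerivAt_pdx

theorem ContDiffOn.differentiableAt_pdx {u : ℝ × ℝ → ℝ} {s : Set (ℝ × ℝ)} {p : ℝ × ℝ}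
    (hu : ContDiffOn ℝ 2 u s) (hs : IsOpen s) (hp : p ∈ s) :
    DifferentiableAt ℝ (pdx u) p := by
  have hfd : DifferentiableAt ℝ (fderiv ℝ u) p :=
    (((hu.contDiffAt (hs.mem_nhds hp)).fderiv_right (m := 1)
      (by norm_num)).differentiableAt (by norm_num))
  have hev : (fun q => fderiv ℝ u q (0, 1)) =ᶠ[nhds p] pdx u := by
    filter_upwards [hs.mem_nhds hp] with q hq
    exact ((hu.contDiffAt (hs.mem_nhds hq)).differentiableAt (by norm_num)).fderiv_zero_one
  exact (hfd.clm_apply (differentiableAt_const _)).congr_of_eventuallyEq hev.symm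

/-- Chain rule for a curve in the plane, in terms of the partial derivatives. -/
theorem DifferentiableAt.hasDerivAt_comp_prodMk {f : ℝ × ℝ → ℝ} {a b : ℝ → ℝ} {a' b' σ : ℝ}
    (hf : DifferentiableAt ℝ f (a σ, b σ)) (ha : HasDerivAt a a' σ) (hb : HasDerivAt b b' σ) :
    HasDerivAt (fun s => f (a s, b s))
      (a' * pdt f (a σ, b σ) + b' * pdx f (a σ, b σ)) σ := by
  have h := HasFDerivAt.comp_hasDerivAt (l := f) σ hf.hasFDerivAt (ha.prodMk hb)
  rw [show ((a', b') : ℝ × ℝ) = a' • (1, 0) + b' • (0, 1) by simp, map_add, map_smul, map_smul,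
    hf.fderiv_one_zero, hf.fderiv_zero_one] at h
  exact h

/-- Along a curve with `(t + x)' = 1`, on which `v` and `w` are the values of `u` and `u_x`, the
derivative of the transformed function is determined by that of the second coordinate of the
transformation. -/
theorem HasDerivAt.transformed_value {κ σ v' w' X' : ℝ} {g v w : ℝ → ℝ} (hκ : κ ≠ 0)
    (hpos : 0 < g σ) (hg : HasDerivAt g 1 σ) (hv : HasDerivAt v v' σ) (hw : HasDerivAt w w' σ)
    (hX : HasDerivAt (fun s => -g s ^ ((κ - 1) / κ) * (κ * g s * w s - v s)) X' σ) :
    HasDerivAt (fun s => g s ^ (-1 / κ) * (κ * g s * w s + (κ - 1) * v s))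
      (g σ ^ (-1 / κ) * κ * (v' - w σ) - X' / g σ) σ := by
  have hr := hg.rpow_const (p := (κ - 1) / κ) (Or.inl hpos.ne')
  have hr' := hg.rpow_const (p := -1 / κ) (Or.inl hpos.ne')
  have hXX := hX.unique (hr.neg.mul (((hg.const_mul κ).mul hw).sub hv))
  have e1 : g σ ^ ((κ - 1) / κ) = g σ ^ (-1 / κ) * g σ := by
    rw [← Real.rpow_add_one hpos.ne']; congr 1; field_simp; ring
  have e2 : g σ ^ ((κ - 1) / κ - 1) = g σ ^ (-1 / κ) := by
    congr 1; field_simp; ring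
  have e3 : g σ ^ (-1 / κ - 1) = g σ ^ (-1 / κ) / g σ := Real.rpow_sub_one hpos.ne' _
  refine (hr'.mul (((hg.const_mul κ).mul hw).add (hv.const_mul (κ - 1)))).congr_deriv ?_
  rw [hXX]
  simp only [Pi.mul_apply, Pi.neg_apply, Pi.add_apply]
  rw [e1, e2, e3]
  have := hpos.ne'
  field_simp
  ring

/-- The first partial derivatives of the transformed function under the contact
transformation Φ built from a solution of the Euler–Poisson equation. -/
theorem first_derivatives_of_transformed_function
    (κ : ℝ) (hκ : κ ≠ 0)
    (Ω : Set (ℝ × ℝ)) (hΩopen : IsOpen Ω)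
    (hΩpos : ∀ p ∈ Ω, 0 < p.1 + p.2)
    (u : ℝ × ℝ → ℝ) (hu : ContDiffOn ℝ 2 u Ω)
    (Φ : ℝ × ℝ → ℝ × ℝ)
    (hΦ : ∀ p : ℝ × ℝ, Φ p = (p.1 / κ,
      -(p.1 + p.2) ^ ((κ - 1) / κ) * (κ * (p.1 + p.2) * pdx u p - u p)))
    (V : Set (ℝ × ℝ)) (hVopen : IsOpen V) (hΦV : Φ '' Ω ⊆ V)
    (hJac : ∀ p ∈ Ω,
      pdt (fun q => (Φ q).1) p * pdx (fun q => (Φ q).2) p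
      - pdx (fun q => (Φ q).1) p * pdt (fun q => (Φ q).2) p ≠ 0)
    (hEP : ∀ p ∈ Ω, pdt (pdx u) p =
      pdt u p / (κ * (p.1 + p.2))
      + 2 * (1 - κ) * pdx u p / (κ * (p.1 + p.2))
      - 2 * (1 - κ) * u p / (κ * (p.1 + p.2)) ^ 2)
    (U : ℝ × ℝ → ℝ) (hU : ContDiffOn ℝ 1 U V)
    (hUΦ : ∀ p ∈ Ω, U (Φ p) =
      (p.1 + p.2) ^ (-1 / κ) * (κ * (p.1 + p.2) * pdx u p + (κ - 1) * u p)) :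
    ∀ p ∈ Ω,
      pdt U (Φ p) = κ ^ 2 * (p.1 + p.2) ^ (-1 / κ) * (pdt u p - pdx u p)
      ∧ pdx U (Φ p) = -(1 / (p.1 + p.2)) := by
  rintro ⟨t, x⟩ hp
  have hpos : 0 < t + x := hΩpos _ hp
  have hud : DifferentiableAt ℝ u (t, x) :=
    (hu.contDiffAt (hΩopen.mem_nhds hp)).differentiableAt (by norm_num)
  have hwd : DifferentiableAt ℝ (pdx u) (t, x) := hu.differentiableAt_pdx hΩopen hp
  have hΦp : Φ (t, x) ∈ V := hΦV (mem_image_of_mem Φ hp)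
  have hUd : DifferentiableAt ℝ U (Φ (t, x)) :=
    (hU.contDiffAt (hVopen.mem_nhds hΦp)).differentiableAt (by norm_num)
  have hXd : DifferentiableAt ℝ (fun q => (Φ q).2) (t, x) := by
    simp only [hΦ]
    have hsum : DifferentiableAt ℝ (fun q : ℝ × ℝ => q.1 + q.2) (t, x) := by fun_prop
    exact (hsum.rpow_const (Or.inl hpos.ne')).neg.mul
      (((hsum.const_mul κ).mul hwd).sub hud)
  have hT : ∀ q, (Φ q).1 = q.1 / κ := fun q => by rw [hΦ]
  have hXt := hXd.hasDerivAt_pdt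
  have hXx := hXd.hasDerivAt_pdx
  have hJ := hJac _ hp
  have hTt : pdt (fun q => (Φ q).1) (t, x) = 1 / κ := by
    simp only [pdt, hT]
    exact ((hasDerivAt_id t).div_const κ).deriv
  have hTx : pdx (fun q => (Φ q).1) (t, x) = 0 := by
    simp [pdx, hT]
  rw [hTt, hTx, zero_mul, sub_zero] at hJ
  have hXx0 := right_ne_zero_of_mul hJ
  set Xt := pdt (fun q => (Φ q).2) (t, x)
  set Xx := pdx (fun q => (Φ q).2) (t, x)
  have hUt := DifferentiableAt.hasDerivAt_comp_prodMk
    (a := fun s => (Φ (s, x)).1) (b := fun s => (Φ (s, x)).2) hUd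
    (by simpa only [hT] using (hasDerivAt_id' t).div_const κ) hXt
  have hUx := DifferentiableAt.hasDerivAt_comp_prodMk
    (a := fun s => (Φ (t, s)).1) (b := fun s => (Φ (t, s)).2) hUd
    (by simpa only [hT] using hasDerivAt_const x (t / κ)) hXx
  simp only [Prod.mk.eta] at hUt hUx
  have hYt := HasDerivAt.transformed_value hκ (g := fun s => s + x) hpos
    ((hasDerivAt_id t).add_const x) hud.hasDerivAt_pdt hwd.hasDerivAt_pdt
    (by simpa only [hΦ] using hXt)
  have hYx := HasDerivAt.transformed_value hκ (g := fun s => t + s) hpos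
    ((hasDerivAt_id x).const_add t) hud.hasDerivAt_pdx hwd.hasDerivAt_pdx
    (by simpa only [hΦ] using hXx)
  have hevt : ∀ᶠ s in nhds t, (s, x) ∈ Ω :=
    (by fun_prop : ContinuousAt (fun s : ℝ => (s, x)) t).eventually (hΩopen.mem_nhds hp)
  have hevx : ∀ᶠ s in nhds x, (t, s) ∈ Ω :=
    (by fun_prop : ContinuousAt (fun s : ℝ => (t, s)) x).eventually (hΩopen.mem_nhds hp)
  have eqt := hUt.unique (hYt.congr_of_eventuallyEq (hevt.mono fun s hs => hUΦ _ hs))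
  have eqx := hUx.unique (hYx.congr_of_eventuallyEq (hevx.mono fun s hs => hUΦ _ hs))
  have hUX : pdx U (Φ (t, x)) = -(1 / (t + x)) := by
    apply mul_left_cancel₀ hXx0
    simp only [sub_self, mul_zero, zero_mul, zero_add, zero_sub] at eqx
    rw [eqx]
    ring
  refine ⟨?_, hUX⟩
  rw [hUX] at eqt
  have hκU : 1 / κ * pdt U (Φ (t, x)) =
      (t + x) ^ (-1 / κ) * κ * (pdt u (t, x) - pdx u (t, x)) := by
    linear_combination eqt
  linear_combination κ * hκU - pdt U (Φ (t, x)) * mul_one_div_cancel hκ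
end

section
/- Let κ ≠ 0 be a real number, let I, J ⊆ ℝ be open intervals with t + x > 0 for all t ∈ I, x ∈ J, and fix x₀ ∈ J. Let S : ℝ → ℝ be C³ on I and let R : ℝ → ℝ be C¹ and nonvanishing on J. Define F(t,x) = ∫_{x₀}^{x} R(s)·(t+s)^(1/κ) ds, G(t,x) = ∫_{x₀}^{x} R(s)·(t+s)^((1−κ)/κ) ds, Φ(t,x) = (t/κ, −κ·(S(t) + F(t,x))), and ũ(t,x) = κ²·S′(t) + κ·G(t,x). Suppose the Jacobian determinant of Φ is nonzero at every point of I × J, V ⊆ ℝ² is open with Φ(I × J) ⊆ V, and U : ℝ² → ℝ is C² on V with U(Φ(t,x)) = ũ(t,x) for all (t,x) ∈ I × J. Then U satisfies the generalized Hunter–Saxton equation at every point of Φ(I × J): writing (t̃,x̃) = Φ(t,x), one has ∂²U/∂t̃∂x̃(t̃,x̃) = U(t̃,x̃)·∂²U/∂x̃²(t̃,x̃) + κ·(∂U/∂x̃(t̃,x̃))². -/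
open Real Set

theorem pdt_eq_fderiv {f : ℝ × ℝ → ℝ} {p : ℝ × ℝ} (hf : DifferentiableAt ℝ f p) :
    pdt f p = fderiv ℝ f p (1, 0) :=
  (hf.hasFDerivAt.comp_hasDerivAt (x := p.1)
    ((hasDerivAt_id p.1).prodMk (hasDerivAt_const p.1 p.2))).deriv

theorem pdx_eq_fderiv {f : ℝ × ℝ → ℝ} {p : ℝ × ℝ} (hf : DifferentiableAt ℝ f p) :
    pdx f p = fderiv ℝ f p (0, 1) :=
  (hf.hasFDerivAt.comp_hasDerivAt (x := p.2)
    ((hasDerivAt_const p.2 p.1).prodMk (hasDerivAt_id p.2))).deriv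

theorem DifferentiableAt.hasDerivAt_comp_pair {f : ℝ × ℝ → ℝ} {g h : ℝ → ℝ} {g' h' s : ℝ}
    (hf : DifferentiableAt ℝ f (g s, h s)) (hg : HasDerivAt g g' s) (hh : HasDerivAt h h' s) :
    HasDerivAt (fun r => f (g r, h r)) (g' * pdt f (g s, h s) + h' * pdx f (g s, h s)) s := by
  have key := hf.hasFDerivAt.comp_hasDerivAt s (hg.prodMk hh)
  have hsplit : ((g', h') : ℝ × ℝ) = g' • ((1, 0) : ℝ × ℝ) + h' • ((0, 1) : ℝ × ℝ) := by simp
  rw [hsplit, map_add, map_smul, map_smul, ← pdt_eq_fderiv hf, ← pdx_eq_fderiv hf] at key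
  exact key

theorem ContDiffAt.differentiableAt_pdx {f : ℝ × ℝ → ℝ} {p : ℝ × ℝ} (hf : ContDiffAt ℝ 2 f p) :
    DifferentiableAt ℝ (pdx f) p := by
  have hfd : DifferentiableAt ℝ (fun q => fderiv ℝ f q (0, 1)) p :=
    ((hf.fderiv_right (m := 1) (by norm_num)).differentiableAt (by norm_num)).clm_apply
      (differentiableAt_const _)
  refine hfd.congr_of_eventuallyEq ?_
  filter_upwards [hf.eventually (by simp)] with q hq
  exact pdx_eq_fderiv (hq.differentiableAt (by norm_num))

section WeightedPowerIntegral

variable {I J : Set ℝ} {R : ℝ → ℝ} {x₀ t x : ℝ}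

theorem continuousOn_mul_add_rpow (hpos : ∀ t ∈ I, ∀ x ∈ J, 0 < t + x) (hR : ContinuousOn R J)
    (a : ℝ) : ContinuousOn (fun q : ℝ × ℝ => R q.2 * (q.1 + q.2) ^ a) (I ×ˢ J) := by
  refine (hR.comp continuousOn_snd fun q hq => hq.2).mul ?_
  exact ContinuousOn.rpow_const (by fun_prop) fun q hq => Or.inl (hpos _ hq.1 _ hq.2).ne'

theorem continuousOn_mul_add_rpow_right (hpos : ∀ t ∈ I, ∀ x ∈ J, 0 < t + x)
    (hR : ContinuousOn R J) (a : ℝ) (ht : t ∈ I) :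
    ContinuousOn (fun s => R s * (t + s) ^ a) J :=
  (continuousOn_mul_add_rpow hpos hR a).comp (f := fun s => (t, s)) (by fun_prop)
    fun _ hs => ⟨ht, hs⟩

theorem hasDerivAt_integral_mul_add_rpow_right (hJopen : IsOpen J) (hJconn : J.OrdConnected)
    (hpos : ∀ t ∈ I, ∀ x ∈ J, 0 < t + x) (hR : ContinuousOn R J) (a : ℝ)
    (hx₀ : x₀ ∈ J) (ht : t ∈ I) (hx : x ∈ J) :
    HasDerivAt (fun y => ∫ s in x₀..y, R s * (t + s) ^ a) (R x * (t + x) ^ a) x := by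
  have hc := continuousOn_mul_add_rpow_right hpos hR a ht
  exact intervalIntegral.integral_hasDerivAt_right
    ((hc.mono (hJconn.uIcc_subset hx₀ hx)).intervalIntegrable)
    (hc.stronglyMeasurableAtFilter hJopen x hx) (hc.continuousAt (hJopen.mem_nhds hx))

theorem hasDerivAt_integral_mul_add_rpow_left (hIopen : IsOpen I) (hJconn : J.OrdConnected)
    (hpos : ∀ t ∈ I, ∀ x ∈ J, 0 < t + x) (hR : ContinuousOn R J) (a : ℝ)
    (hx₀ : x₀ ∈ J) (ht : t ∈ I) (hx : x ∈ J) :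
    HasDerivAt (fun τ => ∫ s in x₀..x, R s * (τ + s) ^ a)
      (a * ∫ s in x₀..x, R s * (t + s) ^ (a - 1)) t := by
  have hsub := hJconn.uIcc_subset hx₀ hx
  obtain ⟨ε, hε, hball⟩ := Metric.nhds_basis_closedBall.mem_iff.1 (hIopen.mem_nhds ht)
  have hrest : ∀ τ ∈ I, ∀ b : ℝ, ContinuousOn (fun s => R s * (τ + s) ^ b) (uIcc x₀ x) :=
    fun τ hτ b => (continuousOn_mul_add_rpow_right hpos hR b hτ).mono hsub
  obtain ⟨C, hC⟩ := ((isCompact_closedBall t ε).prod isCompact_uIcc).exists_bound_of_continuousOn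
    ((continuousOn_mul_add_rpow hpos hR (a - 1)).mono (prod_mono hball hsub))
  rw [← intervalIntegral.integral_const_mul]
  refine (intervalIntegral.hasDerivAt_integral_of_dominated_loc_of_deriv_le
    (F := fun τ s => R s * (τ + s) ^ a) (F' := fun τ s => a * (R s * (τ + s) ^ (a - 1)))
    (bound := fun _ => |a| * C) (Metric.closedBall_mem_nhds t hε) ?_
    (hrest t ht a).intervalIntegrable ?_ ?_ intervalIntegrable_const ?_).2
  · filter_upwards [hIopen.mem_nhds ht] with τ hτ
    exact (hrest τ hτ a).intervalIntegrable.def'.aestronglyMeasurable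
  · exact ((hrest t ht (a - 1)).const_mul a).intervalIntegrable.def'.aestronglyMeasurable
  · refine Filter.Eventually.of_forall fun s hs τ hτ => ?_
    rw [norm_mul, Real.norm_eq_abs a]
    exact mul_le_mul_of_nonneg_left (hC (τ, s) ⟨hτ, uIoc_subset_uIcc hs⟩) (abs_nonneg a)
  · refine Filter.Eventually.of_forall fun s hs τ hτ => ?_
    have hτs := hpos τ (hball hτ) s (hsub (uIoc_subset_uIcc hs))
    refine ((((hasDerivAt_id' τ).add_const s).rpow_const (p := a)
      (Or.inl hτs.ne')).const_mul (R s)).congr_deriv ?_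
    ring

end WeightedPowerIntegral

/-- The parametric formulas for the general solution of the generalized Hunter–Saxton
equation: the function U determined by Φ and ũ solves the Hunter–Saxton equation. -/
theorem parametric_general_solution_of_hunter_saxton
    (κ : ℝ) (hκ : κ ≠ 0)
    (I J : Set ℝ) (hIopen : IsOpen I) (hIconn : I.OrdConnected)
    (hJopen : IsOpen J) (hJconn : J.OrdConnected)
    (hpos : ∀ t ∈ I, ∀ x ∈ J, 0 < t + x)
    (x₀ : ℝ) (hx₀ : x₀ ∈ J)
    (S R : ℝ → ℝ) (hS : ContDiffOn ℝ 3 S I) (hR : ContDiffOn ℝ 1 R J)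
    (hRne : ∀ x ∈ J, R x ≠ 0)
    (F G : ℝ × ℝ → ℝ)
    (hF : ∀ p : ℝ × ℝ, F p = ∫ s in x₀..p.2, R s * (p.1 + s) ^ (1 / κ))
    (hG : ∀ p : ℝ × ℝ, G p = ∫ s in x₀..p.2, R s * (p.1 + s) ^ ((1 - κ) / κ))
    (Φ : ℝ × ℝ → ℝ × ℝ)
    (hΦ : ∀ p : ℝ × ℝ, Φ p = (p.1 / κ, -κ * (S p.1 + F p)))
    (hJac : ∀ p ∈ I ×ˢ J,
      pdt (fun q => (Φ q).1) p * pdx (fun q => (Φ q).2) p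
      - pdx (fun q => (Φ q).1) p * pdt (fun q => (Φ q).2) p ≠ 0)
    (V : Set (ℝ × ℝ)) (hVopen : IsOpen V) (hΦV : Φ '' (I ×ˢ J) ⊆ V)
    (U : ℝ × ℝ → ℝ) (hU : ContDiffOn ℝ 2 U V)
    (hUΦ : ∀ p ∈ I ×ˢ J, U (Φ p) = κ ^ 2 * deriv S p.1 + κ * G p) :
    ∀ p ∈ I ×ˢ J,
      pdt (pdx U) (Φ p) = U (Φ p) * pdx (pdx U) (Φ p) + κ * pdx U (Φ p) ^ 2 := by
  rintro ⟨t, x⟩ ⟨ht, hx⟩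
  have hRc := hR.continuousOn
  have hΦmem : ∀ t ∈ I, ∀ x ∈ J, (t / κ, -κ * (S t + F (t, x))) ∈ V := fun t ht x hx =>
    hΦ (t, x) ▸ hΦV (mem_image_of_mem Φ (mk_mem_prod ht hx))
  have hUV : ∀ q ∈ V, ContDiffAt ℝ 2 U q := fun q hq => hU.contDiffAt (hVopen.mem_nhds hq)
  simp only [hΦ] at hUΦ ⊢
  have hFx : ∀ t ∈ I, ∀ x ∈ J,
      HasDerivAt (fun y => -κ * (S t + F (t, y))) (-κ * (R x * (t + x) ^ (1 / κ))) x := by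
    intro t ht x hx
    simp only [hF]
    exact ((hasDerivAt_integral_mul_add_rpow_right hJopen hJconn hpos hRc _ hx₀ ht hx).const_add
      _).const_mul _
  have hexp : (1 - κ) / κ = 1 / κ - 1 := by field_simp
  -- Differentiating `U ∘ Φ = ũ` in `x` gives `∂U/∂x̃ ∘ Φ = -1 / (t + x)`.
  have hUx : ∀ t ∈ I, ∀ x ∈ J,
      pdx U (t / κ, -κ * (S t + F (t, x))) = -(t + x)⁻¹ := by
    intro t ht x hx
    have hleft := ((hUV _ (hΦmem t ht x hx)).differentiableAt
      (by norm_num)).hasDerivAt_comp_pair (hasDerivAt_const x (t / κ)) (hFx t ht x hx)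
    have hright : HasDerivAt (fun y => κ ^ 2 * deriv S t + κ * G (t, y))
        (κ * (R x * (t + x) ^ ((1 - κ) / κ))) x := by
      simp only [hG]
      exact ((hasDerivAt_integral_mul_add_rpow_right hJopen hJconn hpos hRc _ hx₀ ht
        hx).const_mul _).const_add _
    have heq := hleft.unique (hright.congr_of_eventuallyEq
      (Filter.eventually_of_mem (hJopen.mem_nhds hx) fun y hy => hUΦ (t, y) ⟨ht, hy⟩))
    have htx := hpos t ht x hx
    have hpow := (rpow_pos_of_pos htx (1 / κ)).ne'
    rw [hexp, rpow_sub_one htx.ne', zero_mul, zero_add] at heq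
    have hne : -κ * (R x * (t + x) ^ (1 / κ)) ≠ 0 :=
      mul_ne_zero (neg_ne_zero.2 hκ) (mul_ne_zero (hRne x hx) hpow)
    apply mul_left_cancel₀ hne
    rw [heq]
    ring
  have htx := (hpos t ht x hx).ne'
  have hpdx := (hUV _ (hΦmem t ht x hx)).differentiableAt_pdx
  have hFt : HasDerivAt (fun τ => -κ * (S τ + F (τ, x)))
      (-κ * (deriv S t + 1 / κ * G (t, x))) t := by
    have hSt := ((hS.contDiffAt (hIopen.mem_nhds ht)).differentiableAt (by norm_num)).hasDerivAt
    simp only [hF, hG, hexp]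
    exact (hSt.add (hasDerivAt_integral_mul_add_rpow_left hIopen hJconn hpos hRc _ hx₀ ht
      hx)).const_mul _
  have hUt := (hpdx.hasDerivAt_comp_pair ((hasDerivAt_id t).div_const κ) hFt).unique
    ((((hasDerivAt_id t).add_const x).inv htx).neg.congr_of_eventuallyEq
      (Filter.eventually_of_mem (hIopen.mem_nhds ht) fun τ hτ => hUx τ hτ x hx))
  rw [hUΦ (t, x) ⟨ht, hx⟩, hUx t ht x hx]
  simp only [id] at hUt
  generalize pdt (pdx U) (t / κ, -κ * (S t + F (t, x))) = A at hUt ⊢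
  generalize pdx (pdx U) (t / κ, -κ * (S t + F (t, x))) = B at hUt ⊢
  field_simp at hUt ⊢
  linear_combination hUt
end
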